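/- (Regularity of the parametric solution, uniform case.) Let D ⊂ ℝ^d be a bounded Lipschitz domain, a_0 ∈ L^∞(D), ψ_j ∈ L^∞(D) with ∑_j ‖ψ_j‖_{L^∞} < ∞, and suppose there are 0 < a_min ≤ a_max < ∞ such that a_min ≤ a(x,y) := a_0(x) + ∑_{j≥1} y_j ψ_j(x) ≤ a_max for all x ∈ D and y ∈ [−1/2, 1/2]^ℕ. Let f ∈ H^{−1}(D) and let u(·,y) ∈ H_0^1(D) be the weak solution of −∇·(a(·,y)∇u(·,y)) = f. Then for every finitely supported multi-index ν, ‖∂^ν u(·,y)‖_{H_0^1} ≤ |ν|! · b^ν · ‖f‖_{H^{−1}}/a_min, where b_j := ‖ψ_j‖_{L^∞}/a_min and b^ν = ∏_j b_j^{ν_j}. -/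

import Mathlib

open UniformSpace Filter Topology in
/-- Extension of a bounded bilinear form to an operator on the completion. -/
theorem aux_ext {V : Type*} [NormedAddCommGroup V] [InnerProductSpace ℝ V]
    (B : V →L[ℝ] V →L[ℝ] ℝ) :
    ∃ A : Completion V →L[ℝ] Completion V,
      (∀ x y : V, inner ℝ (A (x : Completion V)) (y : Completion V) = B x y) ∧
      ∀ c : ℝ, 0 < c → (∀ v : V, c * ‖v‖ ^ 2 ≤ B v v) →
        (IsUnit A ∧ ∀ w, c * ‖w‖ ≤ ‖A w‖) := by
  let e : V →L[ℝ] Completion V := Completion.toComplL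
  have hd : DenseRange e := Completion.denseRange_coe
  have he : IsUniformInducing e := Completion.isUniformInducing_coe V
  let C : Completion V →L[ℝ] Completion V →L[ℝ] ℝ :=
    (((B.extend e).flip).extend e).flip
  have hC : ∀ x y : V, C (x : Completion V) (y : Completion V) = B x y := by
    intro x y
    change (((B.extend e).flip).extend e) (e y) (e x) = B x y
    rw [ContinuousLinearMap.extend_eq _ hd he, ContinuousLinearMap.flip_apply,
      ContinuousLinearMap.extend_eq _ hd he]
  refine ⟨InnerProductSpace.continuousLinearMapOfBilin (𝕜 := ℝ) C, ?_, ?_⟩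
  · intro x y
    rw [InnerProductSpace.continuousLinearMapOfBilin_apply]
    exact hC x y
  · intro c hc hv
    have hco : ∀ w : Completion V, c * ‖w‖ * ‖w‖ ≤ C w w := by
      intro w
      induction w using Completion.induction_on with
      | hp => exact isClosed_le (by fun_prop) (by fun_prop)
      | ih v =>
        rw [hC, Completion.norm_coe]
        have := hv v
        nlinarith
    have hcoer : IsCoercive C := ⟨c, hc, hco⟩
    constructor
    · rw [ContinuousLinearMap.isUnit_iff_bijective]
      exact hcoer.continuousLinearEquivOfBilin.bijective
    · intro w
      by_cases h0 : ‖w‖ = 0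
      · simp [h0]
      · have hp : 0 < ‖w‖ := lt_of_le_of_ne (norm_nonneg _) (Ne.symm h0)
        refine le_of_mul_le_mul_right ?_ hp
        refine (hco w).trans ?_
        rw [← InnerProductSpace.continuousLinearMapOfBilin_apply (𝕜 := ℝ) C w w]
        exact real_inner_le_norm _ _

open UniformSpace Filter Topology in
theorem aux_inner_ext {V : Type*} [NormedAddCommGroup V] [InnerProductSpace ℝ V]
    {p q : Completion V} (h : ∀ v : V, inner ℝ p (v : Completion V) = inner ℝ q (v : Completion V)) :
    p = q := by
  refine ext_inner_right ℝ fun w => ?_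
  induction w using Completion.induction_on with
  | hp => exact isClosed_eq (by fun_prop) (by fun_prop)
  | ih v => exact h v

open UniformSpace Filter Topology in
theorem aux_op_ext {V : Type*} [NormedAddCommGroup V] [InnerProductSpace ℝ V]
    {P Q : Completion V →L[ℝ] Completion V}
    (h : ∀ x v : V, inner ℝ (P (x : Completion V)) (v : Completion V)
      = inner ℝ (Q (x : Completion V)) (v : Completion V)) :
    P = Q := by
  ext w
  induction w using Completion.induction_on with
  | hp => exact isClosed_eq (by fun_prop) (by fun_prop)
  | ih v => exact aux_inner_ext (h v)

open UniformSpace Filter Topology in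
theorem aux_norm_le {V : Type*} [NormedAddCommGroup V] [InnerProductSpace ℝ V]
    {p : Completion V} {K : ℝ} (hK : 0 ≤ K) (h : ∀ v : V, |inner ℝ p (v : Completion V)| ≤ K * ‖v‖) :
    ‖p‖ ≤ K := by
  have h2 : ∀ w : Completion V, |inner ℝ p w| ≤ K * ‖w‖ := by
    intro w
    induction w using Completion.induction_on with
    | hp => exact isClosed_le (by fun_prop) (by fun_prop)
    | ih v => rw [Completion.norm_coe]; exact h v
  by_cases h0 : ‖p‖ = 0
  · rw [h0]; exact hK
  · have hp : 0 < ‖p‖ := lt_of_le_of_ne (norm_nonneg _) (Ne.symm h0)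
    have := h2 p
    rw [real_inner_self_eq_norm_sq, abs_of_nonneg (by positivity)] at this
    nlinarith

open Filter Topology in
/-- Two functions agreeing frequently have the same derivative. -/
theorem aux_freq {W : Type*} [NormedAddCommGroup W] [NormedSpace ℝ W] {g h : ℝ → W} {g' h' : W}
    {s : Set ℝ} {t : ℝ} (hg : HasDerivWithinAt g g' s t) (hh : HasDerivWithinAt h h' s t)
    (hf : ∃ᶠ x in 𝓝[s \ {t}] t, g x = h x) : g' = h' := by
  by_contra hne
  have h1 := (hg.sub hh).eventually_ne (c := 0) (sub_ne_zero.2 hne)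
  exact hf (h1.mono fun x hx he => hx (by simp [he]))

open Filter Topology UniformSpace in
theorem aux_step {V : Type*} [NormedAddCommGroup V] [InnerProductSpace ℝ V]
    {g : ℝ → V} {h : ℝ → Completion V} {s : Set ℝ} {t : ℝ} (hs : UniqueDiffWithinAt ℝ s t)
    (hh : DifferentiableWithinAt ℝ h s t)
    (hgh : ∀ x ∈ s, (g x : Completion V) = h x ∨ g x = 0) :
    ((derivWithin g s t : V) : Completion V) = derivWithin h s t ∨ derivWithin g s t = 0 := by
  by_cases hg : DifferentiableWithinAt ℝ g s t
  · have hg1 : HasDerivWithinAt (fun x => (g x : Completion V))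
        ((derivWithin g s t : V) : Completion V) s t :=
      (Completion.toComplL : V →L[ℝ] Completion V).hasFDerivAt.comp_hasDerivWithinAt t
        hg.hasDerivWithinAt
    haveI : NeBot (𝓝[s \ {t}] t) := by
      have := hs.accPt
      rwa [accPt_principal_iff_nhdsWithin] at this
    by_cases hf : ∃ᶠ x in 𝓝[s \ {t}] t, (g x : Completion V) = h x
    · exact Or.inl (aux_freq hg1 hh.hasDerivWithinAt hf)
    · right
      rw [not_frequently] at hf
      have hm : ∀ᶠ x in 𝓝[s \ {t}] t, x ∈ s \ {t} := self_mem_nhdsWithin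
      have h0 : ∀ᶠ x in 𝓝[s \ {t}] t, g x = 0 := by
        filter_upwards [hf, hm] with x hx hxs
        exact (hgh x hxs.1).resolve_left hx
      exact aux_freq (h := fun _ => (0 : V)) hg.hasDerivWithinAt
        (hasDerivWithinAt_const t s 0) h0.frequently
  · exact Or.inr (derivWithin_zero_of_not_differentiableWithinAt hg)

/-- iterated derivative -/
noncomputable def auxD {W : Type*} [NormedAddCommGroup W] [NormedSpace ℝ W]
    (u : (ℕ → ℝ) → W) (js : List ℕ) : (ℕ → ℝ) → W :=
  js.foldr (fun j g z => derivWithin (fun t => g (Function.update z j t))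
            (Set.Icc (-(1/2) : ℝ) (1/2)) (z j)) u

/-- right-hand side of the recursion -/
noncomputable def auxR {W : Type*} [NormedAddCommGroup W] [NormedSpace ℝ W]
    (P : ℕ → W →L[ℝ] W) (r : W)
    (u : (ℕ → ℝ) → W) (js : List ℕ) (z : ℕ → ℝ) : W :=
  (if js.length = 0 then r else 0) -
    ∑ k ∈ Finset.range js.length, P (js.getD k 0) (auxD u (js.eraseIdx k) z)

section
variable {W : Type*} [NormedAddCommGroup W] [NormedSpace ℝ W] [CompleteSpace W]

theorem aux_main (P : ℕ → W →L[ℝ] W) (A : (ℕ → ℝ) → W →L[ℝ] W) (r : W)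
    (u : (ℕ → ℝ) → W) (U : Set (ℕ → ℝ))
    (hU : U = Set.pi Set.univ (fun _ : ℕ => Set.Icc (-(1/2) : ℝ) (1/2)))
    (hA : ∀ z ∈ U, ∀ j, ∀ t ∈ Set.Icc (-(1/2) : ℝ) (1/2),
      A (Function.update z j t) = A z + (t - z j) • P j)
    (hunit : ∀ z ∈ U, IsUnit (A z))
    (hu : ∀ z ∈ U, A z (u z) = r) (n : ℕ) : ∀ js : List ℕ, js.length = n →
    (∀ z ∈ U, A z (auxD u js z) = auxR P r u js z) ∧
    (∀ z ∈ U, ∀ j, DifferentiableWithinAt ℝ (fun t => auxD u js (Function.update z j t))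
      (Set.Icc (-(1/2) : ℝ) (1/2)) (z j)) := by
  have hmem : ∀ z ∈ U, ∀ j, z j ∈ Set.Icc (-(1/2) : ℝ) (1/2) := by
    intro z hz j; rw [hU] at hz; exact hz j trivial
  have hupd : ∀ z ∈ U, ∀ j, ∀ t ∈ Set.Icc (-(1/2) : ℝ) (1/2), Function.update z j t ∈ U := by
    intro z hz j t ht
    rw [hU]
    intro i _
    by_cases h : i = j
    · subst h; simpa using ht
    · rw [Function.update_of_ne h]; exact hmem z hz i
  have hAd : ∀ z ∈ U, ∀ j, HasDerivWithinAt (fun t => A (Function.update z j t)) (P j)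
      (Set.Icc (-(1/2) : ℝ) (1/2)) (z j) := by
    intro z hz j
    have h1 : HasDerivWithinAt (fun t : ℝ => A z + (t - z j) • P j) (P j)
        (Set.Icc (-(1/2) : ℝ) (1/2)) (z j) := by
      have := (((hasDerivWithinAt_id (z j) (Set.Icc (-(1/2) : ℝ) (1/2))).sub_const
        (z j)).smul_const (P j)).const_add (A z)
      simpa using this
    exact h1.congr (fun t ht => hA z hz j t ht) (hA z hz j _ (hmem z hz j))
  have huniq : ∀ z ∈ U, ∀ j, UniqueDiffWithinAt ℝ (Set.Icc (-(1/2) : ℝ) (1/2)) (z j) :=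
    fun z hz j => uniqueDiffOn_Icc (by norm_num) _ (hmem z hz j)
  induction n using Nat.strong_induction_on with
  | _ n ih =>
  intro js hjs
  have ha : ∀ z ∈ U, A z (auxD u js z) = auxR P r u js z := by
    intro z hz
    cases js with
    | nil => simpa [auxD, auxR] using hu z hz
    | cons j js =>
      have hlen : js.length < n := by simp at hjs; omega
      obtain ⟨e1, d1⟩ := ih _ hlen js rfl
      have hdD : HasDerivWithinAt (fun t => auxD u js (Function.update z j t))
          (auxD u (j :: js) z) (Set.Icc (-(1/2) : ℝ) (1/2)) (z j) :=
        (d1 z hz j).hasDerivWithinAt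
      have hL := (hAd z hz j).clm_apply hdD
      have hR : HasDerivWithinAt (fun t => auxR P r u js (Function.update z j t))
          (-∑ k ∈ Finset.range js.length, P (js.getD k 0) (auxD u (j :: js.eraseIdx k) z))
          (Set.Icc (-(1/2) : ℝ) (1/2)) (z j) := by
        unfold auxR
        refine HasDerivWithinAt.const_sub _ (HasDerivWithinAt.fun_sum fun k hk => ?_)
        have hk' : k < js.length := Finset.mem_range.1 hk
        have hl2 : (js.eraseIdx k).length < n := by
          rw [List.length_eraseIdx_of_lt hk']; omega
        exact (P (js.getD k 0)).hasFDerivAt.comp_hasDerivWithinAt (z j)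
          ((ih _ hl2 _ rfl).2 z hz j).hasDerivWithinAt
      have hL' := hL.congr (f₁ := fun t => auxR P r u js (Function.update z j t))
        (fun t ht => (e1 _ (hupd z hz j t ht)).symm)
        (e1 _ (hupd z hz j _ (hmem z hz j))).symm
      have key := (huniq z hz j).eq_deriv _ hL' hR
      rw [Function.update_eq_self] at key
      unfold auxR
      rw [List.length_cons, Finset.sum_range_succ']
      simp only [List.eraseIdx_cons_succ, List.getD_cons_succ, List.eraseIdx_zero, List.tail_cons,
        List.getD_cons_zero]
      rw [← eq_sub_iff_add_eq'] at key
      rw [key]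
      simp
      abel
  refine ⟨ha, ?_⟩
  intro z hz j
  have hR : DifferentiableWithinAt ℝ (fun t => auxR P r u js (Function.update z j t))
      (Set.Icc (-(1/2) : ℝ) (1/2)) (z j) := by
    unfold auxR
    refine DifferentiableWithinAt.const_sub (DifferentiableWithinAt.fun_sum fun k hk => ?_) _
    have hk' : k < js.length := Finset.mem_range.1 hk
    have hl2 : (js.eraseIdx k).length < n := by
      rw [List.length_eraseIdx_of_lt hk']; omega
    exact (P (js.getD k 0)).differentiableAt.comp_differentiableWithinAt (z j)
      ((ih _ hl2 _ rfl).2 z hz j)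
  have hI : DifferentiableWithinAt ℝ (fun t => Ring.inverse (A (Function.update z j t)))
      (Set.Icc (-(1/2) : ℝ) (1/2)) (z j) :=
    DifferentiableWithinAt.inverse (hAd z hz j).differentiableWithinAt
      (by rw [Function.update_eq_self]; exact hunit z hz)
  have hsol : ∀ t ∈ Set.Icc (-(1/2) : ℝ) (1/2), auxD u js (Function.update z j t) =
      Ring.inverse (A (Function.update z j t)) (auxR P r u js (Function.update z j t)) := by
    intro t ht
    have hz' := hupd z hz j t ht
    rw [← ha _ hz', ← ContinuousLinearMap.mul_apply, Ring.inverse_mul_cancel _ (hunit _ hz')]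
    rfl
  exact (hI.clm_apply hR).congr hsol (hsol _ (hmem z hz j))

theorem aux_bound (P : ℕ → W →L[ℝ] W) (A : (ℕ → ℝ) → W →L[ℝ] W) (r : W)
    (u : (ℕ → ℝ) → W) (z : ℕ → ℝ) (amin F : ℝ) (hamin : 0 < amin) (b : ℕ → ℝ)
    (hb : ∀ j, 0 ≤ b j)
    (hP : ∀ j w, ‖P j w‖ ≤ amin * b j * ‖w‖) (hr : ‖r‖ ≤ F)
    (hA : ∀ w, amin * ‖w‖ ≤ ‖A z w‖)
    (heq : ∀ js, A z (auxD u js z) = auxR P r u js z) (n : ℕ) : ∀ js : List ℕ, js.length = n →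
    ‖auxD u js z‖ ≤ (Nat.factorial n : ℝ) * (js.map b).prod * F / amin := by
  induction n with
  | zero =>
    intro js hjs
    have := hA (auxD u js z)
    rw [heq] at this
    rw [List.length_eq_zero_iff] at hjs
    subst hjs
    simp [auxR] at this
    rw [le_div_iff₀ hamin]
    simp
    linarith
  | succ n ih =>
    intro js hjs
    have h1 := hA (auxD u js z)
    rw [heq] at h1
    have h2 : ‖auxR P r u js z‖ ≤ ∑ k ∈ Finset.range js.length,
        (Nat.factorial n : ℝ) * (js.map b).prod * F := by
      unfold auxR
      rw [if_neg (by omega), zero_sub, norm_neg]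
      refine (norm_sum_le _ _).trans (Finset.sum_le_sum fun k hk => ?_)
      have hk' : k < js.length := Finset.mem_range.1 hk
      have hl2 : (js.eraseIdx k).length = n := by
          rw [List.length_eraseIdx_of_lt hk']; omega
      have hprod : b (js.getD k 0) * ((js.eraseIdx k).map b).prod = (js.map b).prod := by
        rw [List.getD_eq_getElem _ _ hk']
        have := ((List.getElem_cons_eraseIdx_perm hk').map b).prod_eq
        simpa using this
      refine (hP _ _).trans ?_
      refine (mul_le_mul_of_nonneg_left (ih _ hl2)
        (mul_nonneg hamin.le (hb _))).trans (le_of_eq ?_)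
      rw [← hprod]
      field_simp
    rw [Finset.sum_const, Finset.card_range, hjs, nsmul_eq_mul] at h2
    rw [le_div_iff₀ hamin, Nat.factorial_succ]
    push_cast at h2 ⊢
    linarith
end


/-- Regularity of the parametric solution, uniform case (abstract variational
formulation).  `V` plays the role of `H_0^1(D)` with `‖v‖ = ‖∇v‖_{L²}`, `B0` the
bilinear form of `a_0`, `Bpsi j` the bilinear form of `ψ_j` (with
`|Bpsi j w v| ≤ ‖ψ_j‖_{L^∞} ‖w‖ ‖v‖`), and `B y = B0 + ∑_j y_j Bpsi j` the bilinear
form of `a(·,y) = a_0 + ∑_j y_j ψ_j`, coercive with constant `a_min` and bounded by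
`a_max` on the parameter cube `U = [−1/2,1/2]^ℕ`.  If `u y` is the weak solution of
`B y (u y) v = f v` for all `v`, then every mixed partial derivative of `u` with
respect to the parameters (taken along a list `js` of coordinate directions, so that
`|ν| = js.length` and `b^ν = ∏_{j ∈ js} b_j`) satisfies
`‖∂^ν u(·,y)‖ ≤ |ν|! · b^ν · ‖f‖/a_min` with `b_j = ‖ψ_j‖_{L^∞}/a_min`. -/
theorem parametric_regularity_uniform
    {V : Type*} [NormedAddCommGroup V] [InnerProductSpace ℝ V]
    (B0 : V →L[ℝ] V →L[ℝ] ℝ) (Bpsi : ℕ → V →L[ℝ] V →L[ℝ] ℝ)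
    (psinorm : ℕ → ℝ) (hpsinn : ∀ j, 0 ≤ psinorm j) (hpsisum : Summable psinorm)
    (hpsibd : ∀ j, ∀ w v : V, |Bpsi j w v| ≤ psinorm j * ‖w‖ * ‖v‖)
    (amin amax : ℝ) (hamin : 0 < amin)
    (U : Set (ℕ → ℝ))
    (hU : U = Set.pi Set.univ (fun _ : ℕ => Set.Icc (-(1/2) : ℝ) (1/2)))
    (B : (ℕ → ℝ) → V →L[ℝ] V →L[ℝ] ℝ)
    (hB : ∀ y ∈ U, ∀ w v : V, B y w v = B0 w v + ∑' j : ℕ, y j * Bpsi j w v)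
    (hcoer : ∀ y ∈ U, ∀ v : V, amin * ‖v‖ ^ 2 ≤ B y v v)
    (hbdd : ∀ y ∈ U, ∀ v : V, B y v v ≤ amax * ‖v‖ ^ 2)
    (f : V →L[ℝ] ℝ) (u : (ℕ → ℝ) → V)
    (hu : ∀ y ∈ U, ∀ v : V, B y (u y) v = f v)
    (b : ℕ → ℝ) (hb : ∀ j, b j = psinorm j / amin) :
    ∀ y ∈ U, ∀ js : List ℕ,
      ‖(js.foldr (fun j g z => derivWithin (fun t => g (Function.update z j t))
            (Set.Icc (-(1/2) : ℝ) (1/2)) (z j)) u) y‖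
        ≤ (Nat.factorial js.length : ℝ) * (js.map b).prod * ‖f‖ / amin := by
  have hmem : ∀ z ∈ U, ∀ j, z j ∈ Set.Icc (-(1/2) : ℝ) (1/2) := by
    intro z hz j; rw [hU] at hz; exact hz j trivial
  have hupd : ∀ z ∈ U, ∀ j, ∀ t ∈ Set.Icc (-(1/2) : ℝ) (1/2), Function.update z j t ∈ U := by
    intro z hz j t ht
    rw [hU]
    intro i _
    by_cases h : i = j
    · subst h; simpa using ht
    · rw [Function.update_of_ne h]; exact hmem z hz i
  have hsum : ∀ z ∈ U, ∀ w v : V, Summable fun j => z j * Bpsi j w v := by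
    intro z hz w v
    refine Summable.of_norm_bounded (g := fun j => psinorm j * (‖w‖ * ‖v‖))
      (hpsisum.mul_right _) fun j => ?_
    have h1 := hmem z hz j
    have h2 : |z j| ≤ 1 := abs_le.2 ⟨by linarith [h1.1], by linarith [h1.2]⟩
    rw [Real.norm_eq_abs, abs_mul]
    calc |z j| * |Bpsi j w v| ≤ 1 * |Bpsi j w v| := by gcongr
      _ ≤ _ := by rw [one_mul, ← mul_assoc]; exact hpsibd j w v
  have hBupd : ∀ z ∈ U, ∀ j, ∀ t ∈ Set.Icc (-(1/2) : ℝ) (1/2), ∀ w v : V,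
      B (Function.update z j t) w v = B z w v + (t - z j) * Bpsi j w v := by
    intro z hz j t ht w v
    rw [hB _ (hupd z hz j t ht), hB z hz]
    have h1 := hsum _ (hupd z hz j t ht) w v
    have h2 := hsum z hz w v
    have h3 := h1.tsum_sub h2
    rw [tsum_eq_single j] at h3
    · simp only [Function.update_self] at h3
      linarith
    · intro i hi
      rw [Function.update_of_ne hi, sub_self]
  choose A hA hAc using fun z => aux_ext (B z)
  choose P hP _ using fun j => aux_ext (Bpsi j)
  obtain ⟨r, hr⟩ : ∃ r : UniformSpace.Completion V, ∀ v : V,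
      inner ℝ r (v : UniformSpace.Completion V) = f v := by
    refine ⟨(InnerProductSpace.toDual ℝ _).symm
      (f.extend (UniformSpace.Completion.toComplL : V →L[ℝ] UniformSpace.Completion V)), ?_⟩
    intro v
    rw [InnerProductSpace.toDual_symm_apply]
    exact ContinuousLinearMap.extend_eq _ UniformSpace.Completion.denseRange_coe
      (UniformSpace.Completion.isUniformInducing_coe V) v
  have hrn : ‖r‖ ≤ ‖f‖ := by
    refine aux_norm_le (norm_nonneg _) fun v => ?_
    rw [hr]; exact f.le_opNorm v
  let uh : (ℕ → ℝ) → UniformSpace.Completion V := fun z => (u z : UniformSpace.Completion V)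
  have hmain := fun n => aux_main P A r uh U hU
    (by
      intro z hz j t ht
      refine aux_op_ext fun x v => ?_
      rw [hA, hBupd z hz j t ht]
      simp only [ContinuousLinearMap.add_apply, ContinuousLinearMap.smul_apply, inner_add_left,
        real_inner_smul_left, hA, hP])
    (fun z hz => (hAc z amin hamin (hcoer z hz)).1)
    (by
      intro z hz
      refine aux_inner_ext fun v => ?_
      rw [hA, hr, hu z hz]) n
  have hbn : ∀ j, 0 ≤ b j := fun j => by rw [hb]; exact div_nonneg (hpsinn j) hamin.le
  have hPn : ∀ j (w : UniformSpace.Completion V), ‖P j w‖ ≤ amin * b j * ‖w‖ := by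
    intro j w
    have : amin * b j = psinorm j := by rw [hb]; field_simp
    rw [this]
    induction w using UniformSpace.Completion.induction_on with
    | hp => exact isClosed_le (by fun_prop) (by fun_prop)
    | ih w =>
      rw [UniformSpace.Completion.norm_coe]
      refine aux_norm_le (mul_nonneg (hpsinn j) (norm_nonneg _)) fun v => ?_
      rw [hP]; exact hpsibd j w v
  have hG : ∀ js : List ℕ, ∀ z ∈ U,
      ((auxD u js z : V) : UniformSpace.Completion V) = auxD uh js z ∨ auxD u js z = 0 := by
    intro js
    induction js with
    | nil => intro z hz; exact Or.inl rfl
    | cons j js ih =>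
      intro z hz
      exact aux_step (uniqueDiffOn_Icc (by norm_num) _ (hmem z hz j))
        ((hmain _ js rfl).2 z hz j) (fun t ht => ih _ (hupd z hz j t ht))
  intro y hy js
  change ‖auxD u js y‖ ≤ _
  rcases hG js y hy with h | h
  · rw [← UniformSpace.Completion.norm_coe, h]
    exact aux_bound P A r uh y amin ‖f‖ hamin b hbn hPn hrn (hAc y amin hamin (hcoer y hy)).2
      (fun js => (hmain _ js rfl).1 y hy) _ js rfl
  · rw [h, norm_zero]
    have : 0 ≤ (js.map b).prod := List.prod_nonneg (by
      intro a ha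
      obtain ⟨j, _, rfl⟩ := List.mem_map.1 ha
      exact hbn j)
    positivity
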